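/- Define f(x) = binomial(x,2)·t + x(ℓ-x)(t-1) + binomial(ℓ-x,2)·(t+ℓ-3) for integer x. Then for every integer x with 0 ≤ x ≤ ℓ, f(x) ≥ binomial(ℓ,2)·(t-1) + binomial(ℓ-1,2). -/

import Mathlib

theorem stmt_2 (t ℓ : ℕ) (ht : 1 ≤ t) (hℓ : 3 ≤ ℓ)
    (x : ℕ) (hx : x ≤ ℓ) :
    Nat.choose ℓ 2 * (t - 1) + Nat.choose (ℓ - 1) 2 ≤
      Nat.choose x 2 * t + x * (ℓ - x) * (t - 1) +
        Nat.choose (ℓ - x) 2 * (t + ℓ - 3) := by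
  obtain ⟨s, rfl⟩ : ∃ s, t = s + 1 := ⟨t - 1, by omega⟩
  obtain ⟨y, rfl⟩ : ∃ y, ℓ = x + y := ⟨ℓ - x, by omega⟩
  have e1 : s + 1 + (x + y) - 3 = s + (x + y - 2) := by omega
  have e2 : x + y - x = y := by omega
  rw [e1, e2, Nat.add_sub_cancel]
  have h1 : (x + y).choose 2 = x.choose 2 + x * y + y.choose 2 := by
    have : (((x + y).choose 2 : ℕ) : ℚ) = ((x.choose 2 + x * y + y.choose 2 : ℕ) : ℚ) := by
      push_cast [Nat.cast_choose_two]
      ring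
    exact_mod_cast this
  have key : (x + y - 1).choose 2 ≤ x.choose 2 + y.choose 2 * (x + y - 2) := by
    rcases y with _ | z
    · have := Nat.choose_le_choose 2 (show x + 0 - 1 ≤ x by omega)
      omega
    · have e3 : x + (z + 1) - 1 = x + z := by omega
      obtain ⟨w, hw⟩ : ∃ w, x + z = w + 1 := ⟨x + z - 1, by omega⟩
      have e4 : x + (z + 1) - 2 = w := by omega
      rw [e3, e4]
      have hq : (w : ℚ) = x + z - 1 := by
        have : ((x + z : ℕ) : ℚ) = ((w + 1 : ℕ) : ℚ) := by rw [hw]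
        push_cast at this
        linarith
      have : (((x + z).choose 2 + z.choose 2 * (x + z) : ℕ) : ℚ)
          = ((x.choose 2 + (z + 1).choose 2 * w : ℕ) : ℚ) := by
        push_cast [Nat.cast_choose_two]
        rw [hq]
        ring
      have h2 : (x + z).choose 2 + z.choose 2 * (x + z)
          = x.choose 2 + (z + 1).choose 2 * w := by exact_mod_cast this
      omega
  rw [h1]
  nlinarith [key]
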